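/- Let Φ be an (N_x+1)×(N_y+1) real matrix and let U : ℝ → M_{(N_x+1)×(N_y+1)}(ℝ) be twice differentiable and satisfy the SBP semi-discrete sine-Gordon scheme U''(t) = Δ̄_h U(t) − Φ·sin U(t) for all t. Then the weighted semi-discrete energy H(t) = ½‖U'(t)‖_Λ² + ½‖∇_h⁺U(t)‖_Λ² + (Φ·(𝟙 − cos U(t)), 𝟙)_Λ is constant in t. -/

import Mathlib

open Matrix

noncomputable section

/-- Forward difference matrix `D⁺` on a grid with `M` points:
`(D⁺)_{j,j} = -1/h`, `(D⁺)_{j,j+1} = 1/h` for the first `M-1` rows, last row zero. -/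
def Dplus (M : ℕ) (h : ℝ) : Matrix (Fin M) (Fin M) ℝ :=
  Matrix.of fun j k =>
    if (j : ℕ) + 1 < M then
      if k = j then -1 / h else if (k : ℕ) = (j : ℕ) + 1 then 1 / h else 0
    else 0

/-- Backward difference matrix `D⁻`: `(D⁻)_{j,j} = 1/h`, `(D⁻)_{j,j-1} = -1/h`
for all rows but the first, first row zero. -/
def Dminus (M : ℕ) (h : ℝ) : Matrix (Fin M) (Fin M) ℝ :=
  Matrix.of fun j k =>
    if 1 ≤ (j : ℕ) then
      if k = j then 1 / h else if (k : ℕ) + 1 = (j : ℕ) then -1 / h else 0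
    else 0

/-- Symmetric second-order difference matrix `D²` with Neumann corners:
diagonal `(-1, -2, …, -2, -1)/h²`, off-diagonals `1/h²`. -/
def D2 (M : ℕ) (h : ℝ) : Matrix (Fin M) (Fin M) ℝ :=
  Matrix.of fun j k =>
    if k = j then (if (j : ℕ) = 0 ∨ (j : ℕ) = M - 1 then -1 / h ^ 2 else -2 / h ^ 2)
    else if (k : ℕ) = (j : ℕ) + 1 ∨ (j : ℕ) = (k : ℕ) + 1 then 1 / h ^ 2
    else 0

/-- SBP weight matrix `Λ = diag(1/2, 1, …, 1, 1/2)`. -/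
def Lam (M : ℕ) : Matrix (Fin M) (Fin M) ℝ :=
  Matrix.of fun j k =>
    if k = j then (if (j : ℕ) = 0 ∨ (j : ℕ) = M - 1 then 1 / 2 else 1) else 0

/-- Regular-grid second-order central difference matrix with ghost-point Neumann closure. -/
def Dbar2 (M : ℕ) (h : ℝ) : Matrix (Fin M) (Fin M) ℝ :=
  Matrix.of fun j k =>
    if (j : ℕ) = 0 then
      if (k : ℕ) = 0 then -2 / h ^ 2 else if (k : ℕ) = 1 then 2 / h ^ 2 else 0
    else if (j : ℕ) = M - 1 then
      if (k : ℕ) = M - 1 then -2 / h ^ 2 else if (k : ℕ) = M - 2 then 2 / h ^ 2 else 0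
    else
      if k = j then -2 / h ^ 2
      else if (k : ℕ) = (j : ℕ) + 1 ∨ (j : ℕ) = (k : ℕ) + 1 then 1 / h ^ 2 else 0

/-- Discrete `L²` inner product `(u,v)_h = h_x h_y ∑_{j,k} u_{jk} v_{jk}`. -/
def iph {m n : ℕ} (hx hy : ℝ) (u v : Matrix (Fin m) (Fin n) ℝ) : ℝ :=
  hx * hy * ∑ j, ∑ k, u j k * v j k

/-- Entrywise `Φ · sin U`. -/
def hadSin {m n : ℕ} (Φ U : Matrix (Fin m) (Fin n) ℝ) : Matrix (Fin m) (Fin n) ℝ :=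
  Matrix.of fun j k => Φ j k * Real.sin (U j k)

/-- Entrywise `Φ · (𝟙 - cos U)`. -/
def hadOneSubCos {m n : ℕ} (Φ U : Matrix (Fin m) (Fin n) ℝ) : Matrix (Fin m) (Fin n) ℝ :=
  Matrix.of fun j k => Φ j k * (1 - Real.cos (U j k))

/-- The all-ones matrix `𝟙`. -/
def oneM (m n : ℕ) : Matrix (Fin m) (Fin n) ℝ := Matrix.of fun _ _ => 1


lemma Lam_eq_diagonal (M : ℕ) :
    Lam M = diagonal fun j : Fin M => if (j : ℕ) = 0 ∨ (j : ℕ) = M - 1 then (1 / 2 : ℝ) else 1 := by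
  ext j k
  simp only [Lam, of_apply, diagonal_apply, eq_comm]

lemma Lam_transpose (M : ℕ) : (Lam M)ᵀ = Lam M := by
  rw [Lam_eq_diagonal, diagonal_transpose]

lemma isUnit_det_Lam (M : ℕ) : IsUnit (Lam M).det := by
  rw [Lam_eq_diagonal, det_diagonal, isUnit_iff_ne_zero, Finset.prod_ne_zero_iff]
  intro j _
  split_ifs <;> norm_num

/-- Summation by parts: `(D⁺)ᵀ D⁺ = -D²`. -/
lemma Dplus_transpose_mul_Dplus {N : ℕ} (hN : 0 < N) (h : ℝ) :
    (Dplus (N + 1) h)ᵀ * Dplus (N + 1) h = -D2 (N + 1) h := by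
  ext j k
  let G : ℕ → ℕ → ℝ := fun l i => (if i + 1 = l then 1 / h else 0) - if i = l then 1 / h else 0
  have hlast : ∀ l : Fin (N + 1), Dplus (N + 1) h (Fin.last N) l = 0 := by
    intro l
    simp [Dplus]
  have hcast : ∀ (i : Fin N) (l : Fin (N + 1)), Dplus (N + 1) h i.castSucc l = G l i := by
    intro i l
    have hi := i.isLt
    simp only [Dplus, G, of_apply, Fin.ext_iff, Fin.val_castSucc]
    split_ifs <;> first | omega | ring
  have hsucc : ∀ i : ℕ, (i + 1 = (j : ℕ)) ↔ (i = (j : ℕ) - 1 ∧ (j : ℕ) ≠ 0) := by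
    intro i
    omega
  have hsum : ∑ i ∈ Finset.range N, G j i * G k i =
      (if (j : ℕ) ≠ 0 then 1 / h * G k (j - 1) else 0) -
        if (j : ℕ) < N then 1 / h * G k j else 0 := by
    have hj := j.isLt
    calc ∑ i ∈ Finset.range N, G j i * G k i
        = ∑ i ∈ Finset.range N, (if i = (j : ℕ) - 1 then
              (if (j : ℕ) ≠ 0 then 1 / h * G k i else 0) else 0) -
            ∑ i ∈ Finset.range N, if i = (j : ℕ) then 1 / h * G k i else 0 := by
          rw [← Finset.sum_sub_distrib]
          refine Finset.sum_congr rfl fun i _ => ?_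
          rw [show G j i = (if i + 1 = (j : ℕ) then 1 / h else 0) -
            if i = (j : ℕ) then 1 / h else 0 from rfl, sub_mul]
          simp only [hsucc, ite_and, ite_mul, zero_mul]
      _ = _ := by
          rw [Finset.sum_ite_eq', Finset.sum_ite_eq', if_pos (Finset.mem_range.2 (by omega))]
          simp only [Finset.mem_range]
  simp only [mul_apply, transpose_apply, Fin.sum_univ_castSucc, hlast, hcast, mul_zero, add_zero]
  rw [Fin.sum_univ_eq_sum_range (fun i => G j i * G k i), hsum]
  have hj := j.isLt
  have hk := k.isLt
  simp only [G, D2, Matrix.neg_apply, of_apply, Fin.ext_iff]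
  split_ifs <;> first | omega | ring

variable {m n : ℕ}

lemma iph_eq_trace (hx hy : ℝ) (u v : Matrix (Fin m) (Fin n) ℝ) :
    iph hx hy u v = hx * hy * (uᵀ * v).trace := by
  rw [iph, Finset.sum_comm]
  simp [trace, mul_apply]

lemma iph_comm (hx hy : ℝ) (u v : Matrix (Fin m) (Fin n) ℝ) :
    iph hx hy u v = iph hx hy v u := by
  simp only [iph, mul_comm]

lemma iph_mul_mul_left (hx hy : ℝ) (A : Matrix (Fin m) (Fin m) ℝ) (B : Matrix (Fin n) (Fin n) ℝ)
    (u v : Matrix (Fin m) (Fin n) ℝ) :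
    iph hx hy (A * u * B) v = iph hx hy u (Aᵀ * v * Bᵀ) := by
  rw [iph_eq_trace, iph_eq_trace, transpose_mul, transpose_mul, Matrix.mul_assoc, trace_mul_comm]
  simp only [Matrix.mul_assoc]

lemma iph_add_right (hx hy : ℝ) (u v w : Matrix (Fin m) (Fin n) ℝ) :
    iph hx hy u (v + w) = iph hx hy u v + iph hx hy u w := by
  simp only [iph_eq_trace, Matrix.mul_add, trace_add, mul_add]

lemma iph_neg_right (hx hy : ℝ) (u v : Matrix (Fin m) (Fin n) ℝ) :
    iph hx hy u (-v) = -iph hx hy u v := by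
  simp only [iph_eq_trace, Matrix.mul_neg, trace_neg, mul_neg]

lemma hasDerivAt_iph (hx hy : ℝ) {u v : ℝ → Matrix (Fin m) (Fin n) ℝ}
    {u' v' : Matrix (Fin m) (Fin n) ℝ} {t : ℝ}
    (hu : ∀ j k, HasDerivAt (fun s => u s j k) (u' j k) t)
    (hv : ∀ j k, HasDerivAt (fun s => v s j k) (v' j k) t) :
    HasDerivAt (fun s => iph hx hy (u s) (v s)) (iph hx hy u' (v t) + iph hx hy (u t) v') t := by
  simp only [iph, ← mul_add, ← Finset.sum_add_distrib]
  exact (HasDerivAt.fun_sum fun j _ => HasDerivAt.fun_sum fun k _ =>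
    (hu j k).mul (hv j k)).const_mul _

lemma hasDerivAt_mul_mul {u : ℝ → Matrix (Fin m) (Fin n) ℝ} {u' : Matrix (Fin m) (Fin n) ℝ}
    {t : ℝ} (A : Matrix (Fin m) (Fin m) ℝ) (B : Matrix (Fin n) (Fin n) ℝ)
    (hu : ∀ j k, HasDerivAt (fun s => u s j k) (u' j k) t) (j : Fin m) (k : Fin n) :
    HasDerivAt (fun s => (A * u s * B) j k) ((A * u' * B) j k) t := by
  simp only [mul_apply]
  exact HasDerivAt.fun_sum fun i _ => (HasDerivAt.fun_sum fun l _ =>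
    (hu l i).const_mul _).mul_const _

/-- A quadratic form `(A u B, C u E)_h` with `Cᵀ A`, `B Eᵀ` symmetric has the derivative
expected from the product rule. -/
lemma hasDerivAt_iph_mul_mul (hx hy : ℝ) {u : ℝ → Matrix (Fin m) (Fin n) ℝ}
    {u' : Matrix (Fin m) (Fin n) ℝ} {t : ℝ} {A C : Matrix (Fin m) (Fin m) ℝ}
    {B E : Matrix (Fin n) (Fin n) ℝ} (hA : (Cᵀ * A)ᵀ = Cᵀ * A) (hB : (B * Eᵀ)ᵀ = B * Eᵀ)
    (hu : ∀ j k, HasDerivAt (fun s => u s j k) (u' j k) t) :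
    HasDerivAt (fun s => 1 / 2 * iph hx hy (A * u s * B) (C * u s * E))
      (iph hx hy u' (Cᵀ * A * u t * (B * Eᵀ))) t := by
  refine ((hasDerivAt_iph hx hy (hasDerivAt_mul_mul A B hu)
    (hasDerivAt_mul_mul C E hu)).const_mul (1 / 2)).congr_deriv ?_
  rw [iph_comm hx hy (A * u t * B), iph_mul_mul_left, iph_mul_mul_left]
  have h1 : Aᵀ * (C * u t * E) * Bᵀ = Cᵀ * A * u t * (B * Eᵀ) := by
    rw [← hA, ← hB]
    simp only [transpose_mul, transpose_transpose, Matrix.mul_assoc]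
  have h2 : Cᵀ * (A * u t * B) * Eᵀ = Cᵀ * A * u t * (B * Eᵀ) := by
    simp only [Matrix.mul_assoc]
  rw [h1, h2]
  ring

lemma hasDerivAt_iph_hadOneSubCos (hx hy : ℝ) (Φ : Matrix (Fin m) (Fin n) ℝ)
    {u : ℝ → Matrix (Fin m) (Fin n) ℝ} {u' : Matrix (Fin m) (Fin n) ℝ} {t : ℝ}
    (hu : ∀ j k, HasDerivAt (fun s => u s j k) (u' j k) t) :
    HasDerivAt (fun s => iph hx hy (Lam m * hadOneSubCos Φ (u s) * Lam n) (oneM m n))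
      (iph hx hy u' (Lam m * hadSin Φ (u t) * Lam n)) t := by
  simp only [iph, Lam_eq_diagonal, mul_diagonal, diagonal_mul, hadOneSubCos, hadSin, oneM,
    of_apply, mul_one]
  refine (HasDerivAt.fun_sum fun j _ => HasDerivAt.fun_sum fun k _ =>
    ((((hu j k).cos.const_sub 1).const_mul (Φ j k)).const_mul _).mul_const _).const_mul _
    |>.congr_deriv ?_
  congr 1
  refine Finset.sum_congr rfl fun j _ => Finset.sum_congr rfl fun k _ => ?_
  ring

/-- Energy conservation for the SBP semi-discrete sine-Gordon scheme (weighted norm). -/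
theorem stmt12 (Nx Ny : ℕ) (hNx : 0 < Nx) (hNy : 0 < Ny)
    (hx hy : ℝ) (hhx : 0 < hx) (hhy : 0 < hy)
    (Φ : Matrix (Fin (Nx + 1)) (Fin (Ny + 1)) ℝ)
    (U U' U'' : ℝ → Matrix (Fin (Nx + 1)) (Fin (Ny + 1)) ℝ)
    (hU : ∀ t j k, HasDerivAt (fun s => U s j k) (U' t j k) t)
    (hU' : ∀ t j k, HasDerivAt (fun s => U' s j k) (U'' t j k) t)
    (hscheme : ∀ t, U'' t =
      (Lam (Nx + 1))⁻¹ * D2 (Nx + 1) hx * U t + U t * D2 (Ny + 1) hy * (Lam (Ny + 1))⁻¹ -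
        hadSin Φ (U t)) :
    ∀ t₁ t₂ : ℝ,
      (1 / 2) * iph hx hy (Lam (Nx + 1) * U' t₁ * Lam (Ny + 1)) (U' t₁) +
        (1 / 2) * (iph hx hy (Dplus (Nx + 1) hx * U t₁ * Lam (Ny + 1)) (Dplus (Nx + 1) hx * U t₁) +
          iph hx hy (Lam (Nx + 1) * (U t₁ * (Dplus (Ny + 1) hy)ᵀ)) (U t₁ * (Dplus (Ny + 1) hy)ᵀ)) +
        iph hx hy (Lam (Nx + 1) * hadOneSubCos Φ (U t₁) * Lam (Ny + 1)) (oneM (Nx + 1) (Ny + 1)) =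
      (1 / 2) * iph hx hy (Lam (Nx + 1) * U' t₂ * Lam (Ny + 1)) (U' t₂) +
        (1 / 2) * (iph hx hy (Dplus (Nx + 1) hx * U t₂ * Lam (Ny + 1)) (Dplus (Nx + 1) hx * U t₂) +
          iph hx hy (Lam (Nx + 1) * (U t₂ * (Dplus (Ny + 1) hy)ᵀ)) (U t₂ * (Dplus (Ny + 1) hy)ᵀ)) +
        iph hx hy (Lam (Nx + 1) * hadOneSubCos Φ (U t₂) * Lam (Ny + 1)) (oneM (Nx + 1) (Ny + 1)) := by
  set X := Lam (Nx + 1)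
  set Y := Lam (Ny + 1)
  set P := Dplus (Nx + 1) hx
  set Q := Dplus (Ny + 1) hy
  have hP : Pᵀ * P = -D2 (Nx + 1) hx := Dplus_transpose_mul_Dplus hNx hx
  have hQ : Qᵀ * Q = -D2 (Ny + 1) hy := Dplus_transpose_mul_Dplus hNy hy
  have hXT : Xᵀ = X := Lam_transpose _
  have hYT : Yᵀ = Y := Lam_transpose _
  have hweighted : ∀ t, X * U'' t * Y =
      -(Pᵀ * P * U t * Y) + -(X * U t * (Qᵀ * Q)) + -(X * hadSin Φ (U t) * Y) := by
    intro t
    have hXX : X * X⁻¹ = 1 := mul_nonsing_inv _ (isUnit_det_Lam _)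
    have hYY : Y⁻¹ * Y = 1 := nonsing_inv_mul _ (isUnit_det_Lam _)
    have h1 : X * (X⁻¹ * D2 (Nx + 1) hx * U t) * Y = D2 (Nx + 1) hx * U t * Y := by
      rw [← Matrix.mul_assoc, ← Matrix.mul_assoc, hXX, Matrix.one_mul]
    have h2 : X * (U t * D2 (Ny + 1) hy * Y⁻¹) * Y = X * U t * D2 (Ny + 1) hy := by
      simp only [Matrix.mul_assoc, hYY, Matrix.mul_one]
    rw [hscheme, Matrix.mul_sub, Matrix.mul_add, Matrix.sub_mul, Matrix.add_mul, h1, h2, hP, hQ]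
    simp only [Matrix.neg_mul, Matrix.mul_neg, neg_neg, sub_eq_add_neg]
  have hderiv : ∀ t, HasDerivAt (fun s =>
      (1 / 2) * iph hx hy (X * U' s * Y) (U' s) +
        (1 / 2) * (iph hx hy (P * U s * Y) (P * U s) +
          iph hx hy (X * (U s * Qᵀ)) (U s * Qᵀ)) +
        iph hx hy (X * hadOneSubCos Φ (U s) * Y) (oneM (Nx + 1) (Ny + 1))) 0 t := by
    intro t
    have kinetic := hasDerivAt_iph_mul_mul hx hy (A := X) (C := 1) (B := Y) (E := 1)
      (by simp [hXT]) (by simp [hYT]) (hU' t)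
    have gradX := hasDerivAt_iph_mul_mul hx hy (A := P) (C := P) (B := Y) (E := 1)
      (by simp) (by simp [hYT]) (hU t)
    have gradY := hasDerivAt_iph_mul_mul hx hy (A := X) (C := 1) (B := Qᵀ) (E := Qᵀ)
      (by simp [hXT]) (by simp) (hU t)
    have potential := hasDerivAt_iph_hadOneSubCos hx hy Φ (hU t)
    simp only [transpose_one, transpose_transpose, Matrix.one_mul, Matrix.mul_one]
      at kinetic gradX gradY
    have hsum := (kinetic.add (gradX.add gradY)).add potential
    refine (hsum.congr_deriv ?_).congr_of_eventuallyEq (.of_forall fun s => ?_)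
    · have hswap : iph hx hy (U'' t) (X * U' t * Y) = iph hx hy (U' t) (X * U'' t * Y) := by
        rw [iph_comm, iph_mul_mul_left, hXT, hYT]
      rw [hswap, hweighted]
      simp only [iph_add_right, iph_neg_right]
      ring
    · simp only [Pi.add_apply, Matrix.mul_assoc]
      ring
  exact is_const_of_deriv_eq_zero (fun t => (hderiv t).differentiableAt) fun t => (hderiv t).deriv

end
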